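/- Let m be a positive integer or half-integer (2m ∈ ℕ) and let n, n', ν, ν' be integers with 0 ≤ n, n' < 2m, 0 ≤ ν, ν' ≤ 2m, n + n' ∈ 2mℤ, and ν + ν' = 2m. Let τ lie in the upper half-plane and z ∈ ℂ with m·z ∉ ℤ + ℤτ. Then G^{[m]}_{n',ν'}(τ, −z) = (−1)^{2m} G^{[m]}_{n,ν}(τ, z). -/

import Mathlib

noncomputable section

open Complex

/-- `e2 w = exp (2 π i w)`; with `q = e^{2πiτ}`, the power `q^x` corresponds to `e2 (x * τ)`. -/
def e2 (w : ℂ) : ℂ := Complex.exp (2 * (Real.pi : ℂ) * Complex.I * w)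

/-- Jacobi-type theta function `θ^{(ε)}_{n,m}(τ, z) = ∑_{j∈ℤ} ε^j q^{m(j+n/(2m))²} e^{2πim(j+n/(2m))z}`. -/
def jtheta (ε n m τ z : ℂ) : ℂ :=
  ∑' j : ℤ, ε ^ j *
    e2 (m * ((j : ℂ) + n / (2 * m)) ^ 2 * τ + m * ((j : ℂ) + n / (2 * m)) * z)

/-- Mock theta function `Φ₁^{(ε)[m,s]}(τ, z₁, z₂)`. -/
def Phi1 (ε m s τ z₁ z₂ : ℂ) : ℂ :=
  ∑' j : ℤ, ε ^ j *
    e2 (m * (j : ℂ) * (z₁ + z₂) + s * z₁ + (m * (j : ℂ) ^ 2 + s * (j : ℂ)) * τ) /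
      (1 - e2 (z₁ + (j : ℂ) * τ))

/-- Dedekind eta function `η(τ) = q^{1/24} ∏_{k≥1} (1 - q^k)`. -/
def dedekindEta (τ : ℂ) : ℂ := e2 (τ / 24) * ∏' k : ℕ, (1 - e2 (((k : ℂ) + 1) * τ))

/-- Jacobi theta `ϑ₁₁(τ, z) = i ∑_{j∈ℤ} (−1)^j q^{(j+1/2)²/2} e^{2πi(j+1/2)z}`. -/
def theta11 (τ z : ℂ) : ℂ :=
  Complex.I * ∑' j : ℤ, (-1 : ℂ) ^ j *
    e2 (((j : ℂ) + 1 / 2) ^ 2 / 2 * τ + ((j : ℂ) + 1 / 2) * z)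

/-- Indefinite double sum `(∑_{j,p∈ℤ, 0<p≤j} − ∑_{j,p∈ℤ, j<p≤0}) f j p`. -/
def indefSum (f : ℤ → ℤ → ℂ) : ℂ :=
  ∑' jp : ℤ × ℤ,
    ((if 0 < jp.2 ∧ jp.2 ≤ jp.1 then f jp.1 jp.2 else 0) -
      (if jp.1 < jp.2 ∧ jp.2 ≤ 0 then f jp.1 jp.2 else 0))

/-- `g^{[m]}_{n,ν}(τ)`. -/
def gfun (m : ℂ) (n ν : ℤ) (τ : ℂ) : ℂ :=
  indefSum fun j p =>
    (-1 : ℂ) ^ j *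
      e2 (((m + 1 / 2) * ((j : ℂ) + (ν : ℂ) - ((ν : ℂ) + 1 / 2) / (2 * m + 1)) ^ 2 -
        m * ((p : ℂ) + (ν : ℂ) - (n : ℂ) / (2 * m)) ^ 2) * τ)

/-- `h^{[m]}_{n,ν}(τ, z)`. -/
def hfun (m : ℂ) (n ν : ℤ) (τ z : ℂ) : ℂ :=
  ∑' j : ℤ,
    e2 (m * (j : ℂ) * z + (n : ℂ) * z / 2 +
        (m * (j : ℂ) ^ 2 + (n : ℂ) * ((j : ℂ) + (ν : ℂ))) * τ) /
      (1 - e2 (m * z + 2 * m * ((j : ℂ) + (ν : ℂ)) * τ))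

/-- `G^{[m]}_{n,ν}(τ, z)`. -/
def Gfun (m : ℂ) (n ν : ℤ) (τ z : ℂ) : ℂ :=
  gfun m n ν τ * jtheta 1 (n : ℂ) m τ z +
    (-1 : ℂ) ^ ν * e2 (-(m * (ν : ℂ) ^ 2) * τ) *
      jtheta (-1) ((ν : ℂ) + 1 / 2) (m + 1 / 2) τ 0 * hfun m n ν τ z

/-- `F^{[m](a,b)}_{n,ν}(τ, z)`. -/
def Ffun (m : ℂ) (a b n ν : ℤ) (τ z : ℂ) : ℂ :=
  e2 ((a : ℂ) * z / 2 + (a : ℂ) ^ 2 / (4 * m) * τ) *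
    Gfun m n ν τ (z + (a : ℂ) * τ / m + (b : ℂ) / m)

/-- The coefficient `f_{j,k}` of Lemma 3.1:
`f_{j,k} = (−1)^j q^{(m+1/2)(j+s/(2m+1))² − k²/(4m)} e^{−2πijm(z₁−z₂)+πik(z₁−z₂)}`. -/
def fcoef (m s τ z₁ z₂ : ℂ) (j k : ℤ) : ℂ :=
  (-1 : ℂ) ^ j *
    e2 (((m + 1 / 2) * ((j : ℂ) + s / (2 * m + 1)) ^ 2 - (k : ℂ) ^ 2 / (4 * m)) * τ +
      (-((j : ℂ) * m) + (k : ℂ) / 2) * (z₁ - z₂))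

lemma e2_add (x y : ℂ) : e2 (x + y) = e2 x * e2 y := by
  unfold e2; rw [← Complex.exp_add]; ring_nf

lemma e2_ne (x : ℂ) : e2 x ≠ 0 := Complex.exp_ne_zero _

lemma e2_zero : e2 0 = 1 := by simp [e2]

lemma e2_nat (k : ℕ) (x : ℂ) : e2 x ^ k = e2 (k * x) := by
  unfold e2; rw [← Complex.exp_nat_mul]; ring_nf

lemma e2_norm (w : ℂ) : ‖e2 w‖ = Real.exp (-(2 * Real.pi * w.im)) := by
  unfold e2
  rw [Complex.norm_exp]
  congr 1
  simp [Complex.mul_re, Complex.mul_im]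

lemma e2_eq_one {w : ℂ} (h : e2 w = 1) : ∃ k : ℤ, w = k := by
  unfold e2 at h
  rw [Complex.exp_eq_one_iff] at h
  obtain ⟨k, hk⟩ := h
  refine ⟨k, ?_⟩
  have h2 : (2 * (Real.pi : ℂ) * Complex.I) ≠ 0 := Complex.two_pi_I_ne_zero
  apply mul_left_cancel₀ h2
  rw [hk]; ring

lemma sgn_even {a b : ℤ} (h : Even (a - b)) : (-1 : ℂ) ^ a = (-1 : ℂ) ^ b := by
  have : a = (a - b) + b := by ring
  rw [this, zpow_add₀ (by norm_num), h.neg_one_zpow, one_mul]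

lemma sgn_odd {a b : ℤ} (h : Odd (a - b)) : (-1 : ℂ) ^ a = -(-1 : ℂ) ^ b := by
  have : a = (a - b) + b := by ring
  rw [this, zpow_add₀ (by norm_num), h.neg_one_zpow, neg_one_mul]

lemma summable_gauss (a b c : ℂ) (ha : 0 < a.im) :
    Summable fun j : ℤ => e2 (a * (j : ℂ) ^ 2 + b * j + c) := by
  have h := (summable_jacobiTheta₂_term_iff b (2 * a)).mpr (by simpa using ha)
  refine (h.mul_left (e2 c)).congr fun j => ?_
  unfold e2 jacobiTheta₂_term
  rw [← Complex.exp_add]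
  congr 1
  ring

lemma norm_sgn (j : ℤ) : ‖(-1 : ℂ) ^ j‖ = 1 := by simp

lemma summable_sgn {f : ℤ → ℂ} (g : ℤ → ℤ) (hf : Summable f) :
    Summable fun j : ℤ => (-1 : ℂ) ^ (g j) * f j := by
  refine Summable.of_norm ?_
  refine hf.norm.congr fun j => ?_
  rw [norm_mul, norm_sgn, one_mul]

lemma theta_refl (M d : ℕ) (hM : 0 < M) (n n' : ℤ) (hn : n' = M * (1 - d) - n) (τ z : ℂ) :
    jtheta 1 (n' : ℂ) ((M : ℂ) / 2) τ (-z) = jtheta 1 (n : ℂ) ((M : ℂ) / 2) τ z := by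
  unfold jtheta
  rw [← (Equiv.subLeft ((d : ℤ) - 1)).tsum_eq]
  refine tsum_congr fun j => ?_
  have hM' : (M : ℂ) ≠ 0 := by exact_mod_cast hM.ne'
  simp only [one_zpow, Equiv.subLeft_apply, one_mul]
  subst hn
  congr 1
  push_cast
  field_simp
  ring

lemma theta_neg (M : ℕ) (ν ν' : ℤ) (hν : ν + ν' = M) (τ : ℂ) :
    jtheta (-1) ((ν' : ℂ) + 1 / 2) ((M : ℂ) / 2 + 1 / 2) τ 0 =
      - jtheta (-1) ((ν : ℂ) + 1 / 2) ((M : ℂ) / 2 + 1 / 2) τ 0 := by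
  unfold jtheta
  rw [← (Equiv.subLeft (-1 : ℤ)).tsum_eq, ← tsum_neg]
  refine tsum_congr fun j => ?_
  have hM' : (M : ℂ) + 1 ≠ 0 := by exact_mod_cast Nat.succ_ne_zero M
  have hν' : ν' = M - ν := by omega
  simp only [Equiv.subLeft_apply]
  subst hν'
  rw [sgn_odd (a := -1 - j) (b := j) ⟨-1 - j, by ring⟩, neg_mul]
  congr 3
  have h2 : (2 * ((M : ℂ) / 2 + 1 / 2)) = M + 1 := by ring
  rw [h2]
  push_cast
  field_simp
  ring

/-- the numerator of the terms of `hfun` -/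
def hA (M : ℕ) (n ν : ℤ) (τ z : ℂ) (j : ℤ) : ℂ :=
  e2 ((M : ℂ) / 2 * (j : ℂ) * z + (n : ℂ) * z / 2 +
        ((M : ℂ) / 2 * (j : ℂ) ^ 2 + (n : ℂ) * ((j : ℂ) + (ν : ℂ))) * τ)

/-- the geometric ratio in the denominators of `hfun` -/
def hX (M : ℕ) (ν : ℤ) (τ z : ℂ) (j : ℤ) : ℂ :=
  e2 ((M : ℂ) / 2 * z + 2 * ((M : ℂ) / 2) * ((j : ℂ) + (ν : ℂ)) * τ)

lemma im_Mtau {M : ℕ} (hM : 0 < M) {τ : ℂ} (hτ : 0 < τ.im) : 0 < ((M : ℂ) / 2 * τ).im := by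
  have : ((M : ℂ) / 2 * τ) = ((M / 2 : ℝ) : ℂ) * τ := by push_cast; ring
  rw [this, Complex.im_ofReal_mul]
  positivity

lemma hA_summable (M : ℕ) (hM : 0 < M) (n ν : ℤ) (τ z : ℂ) (hτ : 0 < τ.im) :
    Summable (hA M n ν τ z) := by
  refine (summable_gauss ((M : ℂ) / 2 * τ) ((M : ℂ) / 2 * z + n * τ) (n * z / 2 + n * ν * τ)
    (im_Mtau hM hτ)).congr fun j => ?_
  unfold hA; congr 1; ring

lemma hX_norm (M : ℕ) (ν : ℤ) (τ z : ℂ) (j : ℤ) :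
    ‖hX M ν τ z j‖ = Real.exp (-(2 * Real.pi * M * τ.im) * j +
      -(2 * Real.pi * ((M : ℝ) / 2 * z.im + M * ν * τ.im))) := by
  unfold hX
  rw [e2_norm]
  congr 1
  have : ((M : ℂ) / 2 * z + 2 * ((M : ℂ) / 2) * ((j : ℂ) + (ν : ℂ)) * τ) =
    ((M / 2 : ℝ) : ℂ) * z + ((M * (j + ν) : ℝ) : ℂ) * τ := by push_cast; ring
  rw [this, Complex.add_im, Complex.im_ofReal_mul, Complex.im_ofReal_mul]
  ring

lemma hterm_summable (M : ℕ) (hM : 0 < M) (n ν : ℤ) (τ z : ℂ) (hτ : 0 < τ.im) :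
    Summable fun j => hA M n ν τ z j / (1 - hX M ν τ z j) := by
  refine Summable.of_norm_bounded_eventually ((hA_summable M hM n ν τ z hτ).norm.mul_left 2) ?_
  have key : ∀ᶠ j : ℤ in Filter.cofinite, 1 / 2 ≤ ‖1 - hX M ν τ z j‖ := by
    have hc : 0 < 2 * Real.pi * M * τ.im := by
      have : (0 : ℝ) < M := by exact_mod_cast hM
      positivity
    rw [Int.cofinite_eq, Filter.eventually_sup]
    constructor
    · have ht : Filter.Tendsto (fun j : ℤ => ‖hX M ν τ z j‖) Filter.atBot Filter.atTop := by
        simp_rw [hX_norm]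
        refine Real.tendsto_exp_atTop.comp (Filter.tendsto_atTop_add_const_right _ _ ?_)
        exact (tendsto_intCast_atBot_iff.mpr Filter.tendsto_id : Filter.Tendsto (fun j : ℤ => (j : ℝ)) Filter.atBot Filter.atBot).const_mul_atBot_of_neg (by linarith)
      filter_upwards [ht.eventually_ge_atTop 2] with j hj
      have h1 := norm_sub_norm_le (hX M ν τ z j) 1
      rw [norm_one] at h1
      rw [norm_sub_rev]
      linarith
    · have ht : Filter.Tendsto (fun j : ℤ => ‖hX M ν τ z j‖) Filter.atTop (nhds 0) := by
        simp_rw [hX_norm]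
        refine Real.tendsto_exp_atBot.comp (Filter.tendsto_atBot_add_const_right _ _ ?_)
        exact (tendsto_intCast_atTop_atTop (R := ℝ)).const_mul_atTop_of_neg (by linarith)
      filter_upwards [ht.eventually_le_const (show (0 : ℝ) < 1 / 2 by norm_num)] with j hj
      have h1 := norm_sub_norm_le 1 (hX M ν τ z j)
      rw [norm_one] at h1
      linarith
  filter_upwards [key] with j hj
  rw [norm_div, div_le_iff₀ (by linarith)]
  nlinarith [norm_nonneg (hA M n ν τ z j)]

lemma hA_pow (M : ℕ) (hM : 0 < M) (n ν : ℤ) (τ z : ℂ) (hτ : 0 < τ.im) (i : ℕ) :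
    HasSum (fun j => hA M n ν τ z j * hX M ν τ z j ^ i)
      (e2 ((M : ℂ) / 2 * ν ^ 2 * τ) *
        (e2 (-((M : ℂ) / 2 * (i + n / M - ν) ^ 2) * τ) * jtheta 1 n ((M : ℂ) / 2) τ z)) := by
  have hM' : (M : ℂ) ≠ 0 := by exact_mod_cast hM.ne'
  have hs : Summable fun j : ℤ => (1 : ℂ) ^ j *
    e2 ((M : ℂ) / 2 * ((j : ℂ) + n / (2 * ((M : ℂ) / 2))) ^ 2 * τ +
      (M : ℂ) / 2 * ((j : ℂ) + n / (2 * ((M : ℂ) / 2))) * z) := by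
    refine (summable_gauss ((M : ℂ) / 2 * τ) ((M : ℂ) / 2 * z + n * τ)
      (n * z / 2 + n ^ 2 / (2 * M) * τ) (im_Mtau hM hτ)).congr fun j => ?_
    rw [one_zpow, one_mul]; congr 1; field_simp; ring
  have h := (hs.hasSum.mul_left (e2 ((M : ℂ) / 2 * ν ^ 2 * τ) *
        e2 (-((M : ℂ) / 2 * (i + n / M - ν) ^ 2) * τ)))
  rw [← (Equiv.addRight (i : ℤ)).hasSum_iff] at h
  rw [← mul_assoc]
  refine Eq.mp (congrArg (fun f => HasSum f _) (funext fun j => ?_)) h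
  symm
  simp only [Function.comp, Equiv.coe_addRight, one_zpow, one_mul]
  unfold hA hX
  rw [e2_nat, ← e2_add, ← e2_add, ← e2_add]
  congr 1
  push_cast
  field_simp
  ring

lemma h_refl (M d : ℕ) (hM : 0 < M) (n n' ν ν' : ℤ) (hn : n' = M * (1 - d) - n)
    (hν : ν + ν' = M) (τ z : ℂ) (hτ : 0 < τ.im)
    (hz : ∀ k l : ℤ, (M : ℂ) / 2 * z ≠ (k : ℂ) + (l : ℂ) * τ) :
    e2 (-((M : ℂ) / 2 * ν' ^ 2) * τ) * hfun ((M : ℂ) / 2) n' ν' τ (-z) =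
      -(e2 (-((M : ℂ) / 2 * ν ^ 2) * τ) * hfun ((M : ℂ) / 2) n ν τ z) +
      (∑ i ∈ Finset.range (M + d), e2 (-((M : ℂ) / 2 * (i + n / M - ν) ^ 2) * τ)) *
        jtheta 1 n ((M : ℂ) / 2) τ z := by
  have hX1 : ∀ j, 1 - hX M ν τ z j ≠ 0 := by
    intro j h
    obtain ⟨k, hk⟩ := e2_eq_one (sub_eq_zero.mp h).symm
    apply hz k (-(M * (j + ν)))
    push_cast
    linear_combination hk
  have h1 : hfun ((M : ℂ) / 2) n' ν' τ (-z) =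
      ∑' j, -(e2 (((M : ℂ) / 2 * M ^ 2 - M ^ 2 * ν) * τ)) *
        (hA M n ν τ z j / (1 - hX M ν τ z j) -
          ∑ i ∈ Finset.range (M + d), hA M n ν τ z j * hX M ν τ z j ^ i) := by
    unfold hfun
    rw [← (Equiv.subLeft (-(M : ℤ))).tsum_eq]
    refine tsum_congr fun j => ?_
    have hg := mul_neg_geom_sum (hX M ν τ z j) (M + d)
    rw [← Finset.mul_sum]
    have e1 : hA M n ν τ z j / (1 - hX M ν τ z j) -
        hA M n ν τ z j * ∑ i ∈ Finset.range (M + d), hX M ν τ z j ^ i =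
        hA M n ν τ z j * hX M ν τ z j ^ (M + d) / (1 - hX M ν τ z j) := by
      have := hX1 j
      field_simp
      linear_combination (-hA M n ν τ z j) * hg
    rw [e1]
    have hν' : ν' = M - ν := by omega
    subst hν' hn
    simp only [Equiv.subLeft_apply]
    have e3 : e2 ((M : ℂ) / 2 * -z + 2 * ((M : ℂ) / 2) *
        (((-(M : ℤ) - j : ℤ) : ℂ) + (((M : ℤ) - ν : ℤ) : ℂ)) * τ) = (hX M ν τ z j)⁻¹ := by
      apply eq_inv_of_mul_eq_one_left
      unfold hX
      rw [← e2_add, ← e2_zero]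
      congr 1
      push_cast
      ring
    rw [e3]
    have hx0 : hX M ν τ z j ≠ 0 := e2_ne _
    have e4 : (1 - (hX M ν τ z j)⁻¹) = -(1 - hX M ν τ z j) / hX M ν τ z j := by
      field_simp; ring
    rw [e4]
    have e5 : ∀ a b x y : ℂ, x ≠ 0 → y ≠ 0 → a * x = b → a / (-y / x) = - (b / y) := by
      intro a b x y hx hy hab
      subst hab; field_simp
    rw [e5 _ _ _ _ hx0 (hX1 j) rfl, neg_mul, ← mul_div_assoc]
    congr 2
    unfold hA hX
    rw [e2_nat, ← e2_add, ← e2_add, ← e2_add]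
    congr 1
    push_cast
    ring
  have h2 : HasSum (fun j => hA M n ν τ z j / (1 - hX M ν τ z j) -
          ∑ i ∈ Finset.range (M + d), hA M n ν τ z j * hX M ν τ z j ^ i)
      (hfun ((M : ℂ) / 2) n ν τ z - ∑ i ∈ Finset.range (M + d),
      (e2 ((M : ℂ) / 2 * ν ^ 2 * τ) *
        (e2 (-((M : ℂ) / 2 * (i + n / M - ν) ^ 2) * τ) * jtheta 1 n ((M : ℂ) / 2) τ z))) := by
    refine HasSum.sub ?_ (hasSum_sum fun i _ => hA_pow M hM n ν τ z hτ i)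
    exact (hterm_summable M hM n ν τ z hτ).hasSum
  rw [h1, (h2.mul_left _).tsum_eq, ← Finset.mul_sum, ← Finset.sum_mul]
  have hν' : (ν' : ℂ) = M - ν := by
    have : ν' = M - ν := by omega
    rw [this]; push_cast; ring
  have a1 : e2 (-((M : ℂ) / 2 * ν' ^ 2) * τ) * e2 (((M : ℂ) / 2 * M ^ 2 - M ^ 2 * ν) * τ) =
      e2 (-((M : ℂ) / 2 * ν ^ 2) * τ) := by
    rw [← e2_add, hν']; congr 1; ring
  have a2 : e2 (-((M : ℂ) / 2 * ν ^ 2) * τ) * e2 ((M : ℂ) / 2 * ν ^ 2 * τ) = 1 := by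
    rw [← e2_add, ← e2_zero]; congr 1; ring
  set S := (∑ i ∈ Finset.range (M + d), e2 (-((M : ℂ) / 2 * (i + n / M - ν) ^ 2) * τ)) *
        jtheta 1 n ((M : ℂ) / 2) τ z
  linear_combination (-(hfun ((M : ℂ) / 2) n ν τ z) + e2 ((M : ℂ) / 2 * ν ^ 2 * τ) * S) * a1 + S * a2

/-- the summand of `gfun` -/
def gF (M : ℕ) (n ν : ℤ) (τ : ℂ) (j p : ℤ) : ℂ :=
  (-1 : ℂ) ^ j *
      e2 ((((M : ℂ) / 2 + 1 / 2) *
        ((j : ℂ) + (ν : ℂ) - ((ν : ℂ) + 1 / 2) / (2 * ((M : ℂ) / 2) + 1)) ^ 2 -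
        (M : ℂ) / 2 * ((p : ℂ) + (ν : ℂ) - (n : ℂ) / (2 * ((M : ℂ) / 2))) ^ 2) * τ)

lemma quad_bound (M : ℕ) (a b : ℝ) : ∃ C : ℝ, ∀ j p : ℝ, |p| ≤ |j| →
    j ^ 2 / 8 + p ^ 2 / 8 - C ≤ ((M : ℝ) / 2 + 1 / 2) * (j + a) ^ 2 - (M : ℝ) / 2 * (p + b) ^ 2 := by
  refine ⟨((M + 1) * |a| + M * |b|) ^ 2 + M / 2 * b ^ 2, fun j p h => ?_⟩
  have hM : (0 : ℝ) ≤ M := by positivity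
  have h1 : p ^ 2 ≤ j ^ 2 := sq_le_sq.mpr h
  have h2 : -(|a| * |j|) ≤ a * j := by rw [← abs_mul]; exact neg_abs_le _
  have h3 : b * p ≤ |b| * |j| :=
    (le_abs_self _).trans (by rw [abs_mul]; exact mul_le_mul_of_nonneg_left h (abs_nonneg _))
  have h4 := sq_abs j
  nlinarith [sq_nonneg (|j| / 2 - ((M + 1) * |a| + M * |b|)), mul_le_mul_of_nonneg_left h1 hM,
    mul_le_mul_of_nonneg_left h2 (by linarith : (0 : ℝ) ≤ M + 1),
    mul_le_mul_of_nonneg_left h3 hM, mul_nonneg hM (sq_nonneg a), sq_nonneg a]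

lemma gF_norm (M : ℕ) (n ν : ℤ) (τ : ℂ) (j p : ℤ) :
    ‖gF M n ν τ j p‖ = Real.exp (-(2 * Real.pi * τ.im *
      (((M : ℝ) / 2 + 1 / 2) * (j + (ν - (ν + 1 / 2) / (2 * ((M : ℝ) / 2) + 1))) ^ 2 -
        (M : ℝ) / 2 * (p + (ν - n / (2 * ((M : ℝ) / 2)))) ^ 2))) := by
  unfold gF
  rw [norm_mul, norm_sgn, one_mul, e2_norm]
  congr 1
  have : ((((M : ℂ) / 2 + 1 / 2) *
        ((j : ℂ) + (ν : ℂ) - ((ν : ℂ) + 1 / 2) / (2 * ((M : ℂ) / 2) + 1)) ^ 2 -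
        (M : ℂ) / 2 * ((p : ℂ) + (ν : ℂ) - (n : ℂ) / (2 * ((M : ℂ) / 2))) ^ 2) * τ) =
     (((((M : ℝ) / 2 + 1 / 2) * (j + (ν - (ν + 1 / 2) / (2 * ((M : ℝ) / 2) + 1))) ^ 2 -
        (M : ℝ) / 2 * (p + (ν - n / (2 * ((M : ℝ) / 2)))) ^ 2 : ℝ)) : ℂ) * τ := by
    push_cast; ring
  rw [this, Complex.im_ofReal_mul]
  ring

lemma gT_summable (M : ℕ) (n ν : ℤ) (τ : ℂ) (hτ : 0 < τ.im) :
    Summable fun jp : ℤ × ℤ =>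
    ((if 0 < jp.2 ∧ jp.2 ≤ jp.1 then gF M n ν τ jp.1 jp.2 else 0) -
      (if jp.1 < jp.2 ∧ jp.2 ≤ 0 then gF M n ν τ jp.1 jp.2 else 0)) := by
  obtain ⟨C, hC⟩ := quad_bound M (ν - (ν + 1 / 2) / (2 * ((M : ℝ) / 2) + 1))
    (ν - n / (2 * ((M : ℝ) / 2)))
  have hg : Summable fun j : ℤ => e2 (τ / 8 * (j : ℂ) ^ 2 + 0 * j + 0) :=
    summable_gauss (τ / 8) 0 0 (by simpa using hτ)
  have hs := (hg.norm.mul_norm hg.norm).mul_left (Real.exp (2 * Real.pi * τ.im * C))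
  have hE : ∀ j : ℤ, ‖e2 (τ / 8 * (j : ℂ) ^ 2 + 0 * j + 0)‖ =
      Real.exp (-(2 * Real.pi * τ.im * (j ^ 2 / 8))) := by
    intro j
    rw [e2_norm]
    congr 1
    have : (τ / 8 * (j : ℂ) ^ 2 + 0 * j + 0) = ((j ^ 2 / 8 : ℝ) : ℂ) * τ := by push_cast; ring
    rw [this, Complex.im_ofReal_mul]; ring
  have hb : ∀ j p : ℤ, |p| ≤ |j| → ‖gF M n ν τ j p‖ ≤ Real.exp (2 * Real.pi * τ.im * C) *
      ‖e2 (τ / 8 * (j : ℂ) ^ 2 + 0 * j + 0) * e2 (τ / 8 * (p : ℂ) ^ 2 + 0 * p + 0)‖ := by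
    intro j p h
    rw [norm_mul, hE, hE, gF_norm, ← Real.exp_add, ← Real.exp_add, Real.exp_le_exp]
    have h1 := hC j p (by exact_mod_cast h)
    have h2 : 0 < 2 * Real.pi * τ.im := by positivity
    have h3 := mul_le_mul_of_nonneg_left h1 h2.le
    linarith
  refine Summable.of_norm_bounded hs ?_
  rintro ⟨j, p⟩
  dsimp only
  split_ifs with h1 h2 h2
  · omega
  · rw [sub_zero]; exact hb j p (by
      rw [abs_of_pos h1.1, abs_of_pos (by omega)]; omega)
  · rw [zero_sub, norm_neg]; exact hb j p (by
      rw [abs_of_nonpos h2.2, abs_of_neg (by omega)]; omega)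
  · simp; positivity

lemma diag (M : ℕ) (hM : 0 < M) (n ν : ℤ) (τ : ℂ) (hτ : 0 < τ.im) (c : ℕ) :
    HasSum (fun p : ℤ => gF M n ν τ (p + c) p) 0 := by
  have hM' : (M : ℂ) ≠ 0 := by exact_mod_cast hM.ne'
  have hM1 : (M : ℂ) + 1 ≠ 0 := by exact_mod_cast Nat.succ_ne_zero M
  have h2 : 2 * ((M : ℂ) / 2) = M := by ring
  have hs : Summable (fun p : ℤ => gF M n ν τ (p + c) p) := by
    unfold gF
    refine summable_sgn (fun p => p + c) ?_
    refine (summable_gauss (τ / 2) ((c * (M + 1) + n - 1 / 2) * τ)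
      ((((M : ℂ) / 2 + 1 / 2) * (c + ν - (ν + 1 / 2) / (M + 1)) ^ 2
        - (M : ℂ) / 2 * (ν - n / M) ^ 2) * τ) (by simpa using hτ)).congr fun p => ?_
    rw [h2]
    congr 1
    push_cast
    field_simp
    ring
  have h := hs.hasSum
  have h0 : (∑' p : ℤ, gF M n ν τ (p + c) p) = -(∑' p : ℤ, gF M n ν τ (p + c) p) := by
    conv_lhs => rw [← (Equiv.subLeft (1 - 2 * n - 2 * (M + 1) * c)).tsum_eq]
    rw [← tsum_neg]
    refine tsum_congr fun p => ?_
    simp only [Equiv.subLeft_apply]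
    unfold gF
    rw [sgn_odd (a := 1 - 2 * n - 2 * (M + 1) * c - p + c) (b := p + c)
      ⟨- n - (M + 1) * c - p, by ring⟩, neg_mul, h2]
    congr 3
    push_cast
    field_simp
    ring
  have : (∑' p : ℤ, gF M n ν τ (p + c) p) = 0 := self_eq_neg.mp h0
  rwa [this] at h

lemma strip (M : ℕ) (hM : 0 < M) (n ν : ℤ) (τ : ℂ) (hτ : 0 < τ.im) (i : ℕ) :
    HasSum (fun j : ℤ => gF M n ν τ j (-i))
      ((-1 : ℂ) ^ ν * jtheta (-1) ((ν : ℂ) + 1 / 2) ((M : ℂ) / 2 + 1 / 2) τ 0 *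
        e2 (-((M : ℂ) / 2 * (i + n / M - ν) ^ 2) * τ)) := by
  have hM' : (M : ℂ) ≠ 0 := by exact_mod_cast hM.ne'
  have hM1 : (M : ℂ) + 1 ≠ 0 := by exact_mod_cast Nat.succ_ne_zero M
  have h2 : 2 * ((M : ℂ) / 2) = M := by ring
  have h3 : 2 * ((M : ℂ) / 2 + 1 / 2) = M + 1 := by ring
  have hs : Summable (fun j : ℤ => gF M n ν τ j (-i)) := by
    unfold gF
    refine summable_sgn (fun p => p) ?_
    have := im_Mtau (Nat.succ_pos M) hτ
    refine (summable_gauss (((M + 1 : ℕ) : ℂ) / 2 * τ) ((ν * (M + 1) - ν - 1 / 2) * τ)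
      ((((M : ℂ) / 2 + 1 / 2) * (ν - (ν + 1 / 2) / (M + 1)) ^ 2
        - (M : ℂ) / 2 * (-i + ν - n / M) ^ 2) * τ) this).congr fun p => ?_
    rw [h2]
    congr 1
    push_cast
    field_simp
    ring
  have h := hs.hasSum
  convert h using 1
  rw [← (Equiv.subLeft (-ν)).tsum_eq]
  unfold jtheta
  rw [← tsum_mul_left, ← tsum_mul_right]
  refine tsum_congr fun j => ?_
  simp only [Equiv.subLeft_apply]
  unfold gF
  rw [sgn_even (a := -ν - j) (b := ν + j) ⟨-ν - j, by ring⟩, zpow_add₀ (by norm_num), h2, h3]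
  rw [← mul_assoc, mul_assoc, ← e2_add]
  congr 2
  push_cast
  field_simp
  ring

lemma sum_ite_range (K : ℕ) (a : ℤ) (F : ℂ) :
    (∑ i ∈ Finset.range K, if a = (i : ℤ) then F else 0) = if 0 ≤ a ∧ a < K then F else 0 := by
  split_ifs with h
  · rw [Finset.sum_eq_single a.toNat]
    · rw [if_pos (by omega)]
    · intro b _ hb
      rw [if_neg (by omega)]
    · intro hb
      rw [Finset.mem_range] at hb
      omega
  · refine Finset.sum_eq_zero fun i hi => ?_
    rw [Finset.mem_range] at hi
    rw [if_neg (by omega)]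

lemma g_refl (M d : ℕ) (hM : 0 < M) (n n' ν ν' : ℤ) (hn : n' = M * (1 - d) - n)
    (hν : ν + ν' = M) (τ : ℂ) (hτ : 0 < τ.im) :
    gfun ((M : ℂ) / 2) n' ν' τ = (-1 : ℂ) ^ M * (gfun ((M : ℂ) / 2) n ν τ +
      (-1 : ℂ) ^ ν * jtheta (-1) ((ν : ℂ) + 1 / 2) ((M : ℂ) / 2 + 1 / 2) τ 0 *
        ∑ i ∈ Finset.range (M + d), e2 (-((M : ℂ) / 2 * (i + n / M - ν) ^ 2) * τ)) := by
  have hM' : (M : ℂ) ≠ 0 := by exact_mod_cast hM.ne'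
  have hM1 : (M : ℂ) + 1 ≠ 0 := by exact_mod_cast Nat.succ_ne_zero M
  have h2 : 2 * ((M : ℂ) / 2) = M := by ring
  have hS : ∀ i : ℕ, HasSum (fun jp : ℤ × ℤ => if -jp.2 = (i : ℤ) then gF M n ν τ jp.1 jp.2 else 0)
      ((-1 : ℂ) ^ ν * jtheta (-1) ((ν : ℂ) + 1 / 2) ((M : ℂ) / 2 + 1 / 2) τ 0 *
        e2 (-((M : ℂ) / 2 * (i + n / M - ν) ^ 2) * τ)) := by
    intro i
    have hinj : Function.Injective (fun j : ℤ => ((j, -(i : ℤ)) : ℤ × ℤ)) := by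
      intro a b h
      exact (Prod.mk.inj h).1
    rw [← hinj.hasSum_iff]
    · convert strip M hM n ν τ hτ i using 1
      funext j
      simp
    · rintro ⟨j, p⟩ h
      refine if_neg fun h' => h ⟨j, ?_⟩
      dsimp only at h' ⊢
      rw [← h', neg_neg]
  have hD : ∀ c : ℕ, HasSum
      (fun jp : ℤ × ℤ => if jp.1 - jp.2 = (c : ℤ) then gF M n ν τ jp.1 jp.2 else 0) 0 := by
    intro c
    have hinj : Function.Injective (fun p : ℤ => ((p + (c : ℤ), p) : ℤ × ℤ)) := by
      intro a b h
      exact (Prod.mk.inj h).2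
    rw [← hinj.hasSum_iff]
    · convert diag M hM n ν τ hτ c using 1
      funext j
      simp
    · rintro ⟨j, p⟩ h
      refine if_neg fun h' => h ⟨p, ?_⟩
      dsimp only at h' ⊢
      rw [← h', add_sub_cancel]
  have hG := (gT_summable M n ν τ hτ).hasSum
  have hTot := ((hG.add (hasSum_sum (s := Finset.range (M + d)) fun i _ => hS i)).sub
    (hasSum_sum (s := Finset.range (d + 1)) fun c _ => hD c)).mul_left ((-1 : ℂ) ^ M)
  rw [Finset.sum_const_zero, sub_zero, ← Finset.mul_sum] at hTot
  change HasSum _ ((-1 : ℂ) ^ M * (gfun ((M : ℂ) / 2) n ν τ + _)) at hTot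
  rw [← hTot.tsum_eq]
  unfold gfun indefSum
  rw [← (Equiv.prodCongr (Equiv.subLeft (1 - (M : ℤ)))
    (Equiv.subLeft (1 - (d : ℤ) - M))).tsum_eq]
  refine tsum_congr ?_
  rintro ⟨j, p⟩
  have hν' : ν' = M - ν := by omega
  have hF : gF M n' ν' τ (1 - (M : ℤ) - j) (1 - (d : ℤ) - M - p) =
      -((-1 : ℂ) ^ M * gF M n ν τ j p) := by
    subst hν' hn
    unfold gF
    rw [← zpow_natCast (-1 : ℂ) M, ← mul_assoc, ← zpow_add₀ (by norm_num : (-1 : ℂ) ≠ 0),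
      sgn_odd (a := 1 - (M : ℤ) - j) (b := (M : ℤ) + j) ⟨-M - j, by ring⟩, neg_mul, h2]
    congr 3
    push_cast
    field_simp
    ring
  simp only [sum_ite_range, Equiv.prodCongr_apply, Prod.map, Equiv.subLeft_apply]
  change ((if _ then gF M n' ν' τ (1 - (M : ℤ) - j) (1 - (d : ℤ) - M - p) else 0) -
    (if _ then gF M n' ν' τ (1 - (M : ℤ) - j) (1 - (d : ℤ) - M - p) else 0)) = _
  rw [hF]
  push_cast
  split_ifs <;> first | omega | ring

theorem stmt_14 (M : ℕ) (hM : 0 < M) (m : ℂ) (hm : m = (M : ℂ) / 2)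
    (n n' ν ν' : ℤ) (hn : 0 ≤ n ∧ n < (M : ℤ)) (hn' : 0 ≤ n' ∧ n' < (M : ℤ))
    (hν : 0 ≤ ν ∧ ν ≤ (M : ℤ)) (hν' : 0 ≤ ν' ∧ ν' ≤ (M : ℤ))
    (hnn' : ∃ k : ℤ, n + n' = (M : ℤ) * k) (hνν' : ν + ν' = (M : ℤ))
    (τ : ℂ) (hτ : 0 < τ.im) (z : ℂ)
    (hz : ∀ k l : ℤ, m * z ≠ (k : ℂ) + (l : ℂ) * τ) :
    Gfun m n' ν' τ (-z) = (-1 : ℂ) ^ M * Gfun m n ν τ z := by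
  subst hm
  obtain ⟨k, hk⟩ := hnn'
  have hMpos : (0 : ℤ) < M := by exact_mod_cast hM
  have hk2 : k < 2 := by
    by_contra h
    push Not at h
    nlinarith
  obtain ⟨d, hd⟩ : ∃ d : ℕ, (d : ℤ) = 1 - k := ⟨(1 - k).toNat, by omega⟩
  have hn2 : n' = M * (1 - d) - n := by rw [hd]; linarith
  have hs : (-1 : ℂ) ^ ν' = (-1 : ℂ) ^ M * (-1 : ℂ) ^ ν := by
    rw [← zpow_natCast, ← zpow_add₀ (by norm_num : (-1 : ℂ) ≠ 0)]
    exact sgn_even ⟨-ν, by omega⟩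
  have hh := h_refl M d hM n n' ν ν' hn2 hνν' τ z hτ hz
  unfold Gfun
  rw [theta_refl M d hM n n' hn2, theta_neg M ν ν' hνν', g_refl M d hM n n' ν ν' hn2 hνν' τ hτ, hs]
  linear_combination (-((-1 : ℂ) ^ M * (-1 : ℂ) ^ ν *
    jtheta (-1) ((ν : ℂ) + 1 / 2) ((M : ℂ) / 2 + 1 / 2) τ 0)) * hh
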